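/- arXiv:2507.18327 — 4 statements merged into one kernel-verified Lean document; each statement's English description precedes it below -/
import Mathlib

section
/- (Elimination theorem) Let A be an invertible real n₁×n₁ matrix and λ > 0. Suppose that for the input M₀ = X₀ + S₀, the pair (X₀, S₀) is the unique minimizer of ‖A X‖_* + λ ‖S‖_1 over all pairs (X, S) of n₁×n₂ matrices with X + S = M₀. Let S₀' be any trimmed version of S₀, i.e., S₀' = P_{Ω₀}(S₀) for some index set Ω₀ (so every nonzero entry of S₀' equals the corresponding entry of S₀). Then (X₀, S₀') is the unique minimizer of ‖A X‖_* + λ ‖S‖_1 over all pairs (X, S) with X + S = X₀ + S₀'. -/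
open Matrix BigOperators

attribute [local instance] Classical.propDecidable

noncomputable def nuclearNorm {m n : ℕ} (M : Matrix (Fin m) (Fin n) ℝ) : ℝ :=
  ∑ i, Real.sqrt ((Matrix.isHermitian_conjTranspose_mul_self M).eigenvalues i)

noncomputable def frobNorm {m n : ℕ} (M : Matrix (Fin m) (Fin n) ℝ) : ℝ :=
  Real.sqrt (∑ i, ∑ j, (M i j) ^ 2)

noncomputable def l1Norm {m n : ℕ} (M : Matrix (Fin m) (Fin n) ℝ) : ℝ :=
  ∑ i, ∑ j, |M i j|

noncomputable def supNorm {m n : ℕ} (M : Matrix (Fin m) (Fin n) ℝ) : ℝ :=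
  ⨆ p : Fin m × Fin n, |M p.1 p.2|

noncomputable def specNorm {m n : ℕ} (M : Matrix (Fin m) (Fin n) ℝ) : ℝ :=
  ⨆ i, Real.sqrt ((Matrix.isHermitian_conjTranspose_mul_self M).eigenvalues i)

noncomputable def PΩ {m n : ℕ} (Ω : Finset (Fin m × Fin n)) (M : Matrix (Fin m) (Fin n) ℝ) :
    Matrix (Fin m) (Fin n) ℝ :=
  fun i j => if (i, j) ∈ Ω then M i j else 0

noncomputable def PΩc {m n : ℕ} (Ω : Finset (Fin m × Fin n)) (M : Matrix (Fin m) (Fin n) ℝ) :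
    Matrix (Fin m) (Fin n) ℝ :=
  M - PΩ Ω M

noncomputable def PT {m n r : ℕ} (U : Matrix (Fin m) (Fin r) ℝ) (V : Matrix (Fin n) (Fin r) ℝ)
    (M : Matrix (Fin m) (Fin n) ℝ) : Matrix (Fin m) (Fin n) ℝ :=
  U * Uᵀ * M + M * (V * Vᵀ) - U * Uᵀ * M * (V * Vᵀ)

noncomputable def PTperp {m n r : ℕ} (U : Matrix (Fin m) (Fin r) ℝ) (V : Matrix (Fin n) (Fin r) ℝ)
    (M : Matrix (Fin m) (Fin n) ℝ) : Matrix (Fin m) (Fin n) ℝ :=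
  (1 - U * Uᵀ) * M * (1 - V * Vᵀ)

noncomputable def opNorm {m n : ℕ}
    (L : Matrix (Fin m) (Fin n) ℝ → Matrix (Fin m) (Fin n) ℝ) : ℝ :=
  ⨆ X : {X : Matrix (Fin m) (Fin n) ℝ // frobNorm X ≤ 1}, frobNorm (L X.1)

noncomputable def sgn {m n : ℕ} (S : Matrix (Fin m) (Fin n) ℝ) : Matrix (Fin m) (Fin n) ℝ :=
  fun i j => Real.sign (S i j)

def IsReducedSVD {m n r : ℕ} (X : Matrix (Fin m) (Fin n) ℝ) (U : Matrix (Fin m) (Fin r) ℝ)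
    (S : Matrix (Fin r) (Fin r) ℝ) (V : Matrix (Fin n) (Fin r) ℝ) : Prop :=
  Uᵀ * U = 1 ∧ Vᵀ * V = 1 ∧ S.IsDiag ∧ (∀ i, 0 < S i i) ∧ X = U * S * Vᵀ

def IncoherentUV {m n r : ℕ} (U : Matrix (Fin m) (Fin r) ℝ) (V : Matrix (Fin n) (Fin r) ℝ)
    (μ : ℝ) : Prop :=
  (∀ k, ∑ i, (U k i) ^ 2 ≤ μ * (r : ℝ) / (m : ℝ)) ∧
  (∀ k, ∑ i, (V k i) ^ 2 ≤ μ * (r : ℝ) / (n : ℝ)) ∧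
  ∀ i j, |(U * Vᵀ) i j| ≤ Real.sqrt (μ * (r : ℝ) / ((m : ℝ) * (n : ℝ)))

def HasIncoherentSVD {m n : ℕ} (X : Matrix (Fin m) (Fin n) ℝ) (r : ℕ) (μ : ℝ) : Prop :=
  ∃ (U : Matrix (Fin m) (Fin r) ℝ) (S : Matrix (Fin r) (Fin r) ℝ) (V : Matrix (Fin n) (Fin r) ℝ),
    IsReducedSVD X U S V ∧ IncoherentUV U V μ

def UniqueRPCAMin {n₁ n₂ : ℕ} (A : Matrix (Fin n₁) (Fin n₁) ℝ) (lam : ℝ)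
    (M X₀ S₀ : Matrix (Fin n₁) (Fin n₂) ℝ) : Prop :=
  X₀ + S₀ = M ∧ ∀ X S : Matrix (Fin n₁) (Fin n₂) ℝ, X + S = M → (X, S) ≠ (X₀, S₀) →
    nuclearNorm (A * X₀) + lam * l1Norm S₀ < nuclearNorm (A * X) + lam * l1Norm S

def memT {n₁ n₂ r : ℕ} (U : Matrix (Fin n₁) (Fin r) ℝ) (V : Matrix (Fin n₂) (Fin r) ℝ)
    (M : Matrix (Fin n₁) (Fin n₂) ℝ) : Prop :=
  ∃ (X : Matrix (Fin n₂) (Fin r) ℝ) (Y : Matrix (Fin n₁) (Fin r) ℝ), M = U * Xᵀ + Y * Vᵀ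

noncomputable def berProb (n₁ n₂ : ℕ) (p : ℝ) (E : Finset (Fin n₁ × Fin n₂) → Prop) : ℝ :=
  ∑ Ω : Finset (Fin n₁ × Fin n₂),
    (if E Ω then (1 : ℝ) else 0) * p ^ Ω.card * (1 - p) ^ (n₁ * n₂ - Ω.card)

theorem l1Norm_add_le {m n : ℕ} (M N : Matrix (Fin m) (Fin n) ℝ) :
    l1Norm (M + N) ≤ l1Norm M + l1Norm N := by
  simp only [l1Norm, ← Finset.sum_add_distrib]
  exact Finset.sum_le_sum fun i _ => Finset.sum_le_sum fun j _ => abs_add_le _ _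

theorem l1Norm_PΩ_add_l1Norm_PΩc {m n : ℕ} (Ω : Finset (Fin m × Fin n))
    (M : Matrix (Fin m) (Fin n) ℝ) : l1Norm (PΩ Ω M) + l1Norm (PΩc Ω M) = l1Norm M := by
  simp only [l1Norm, ← Finset.sum_add_distrib]
  refine Finset.sum_congr rfl fun i _ => Finset.sum_congr rfl fun j _ => ?_
  by_cases hij : (i, j) ∈ Ω <;> simp [PΩc, PΩ, hij]

theorem elimination_theorem {n₁ n₂ : ℕ} (A : Matrix (Fin n₁) (Fin n₁) ℝ) (hA : IsUnit A)
    (lam : ℝ) (hlam : 0 < lam) (X₀ S₀ : Matrix (Fin n₁) (Fin n₂) ℝ)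
    (h : UniqueRPCAMin A lam (X₀ + S₀) X₀ S₀)
    (Ω₀ : Finset (Fin n₁ × Fin n₂)) :
    UniqueRPCAMin A lam (X₀ + PΩ Ω₀ S₀) X₀ (PΩ Ω₀ S₀) := by
  refine ⟨rfl, fun X S hXS hne => ?_⟩
  have hlt := h.2 X (S + PΩc Ω₀ S₀)
    (by rw [← add_assoc, hXS, PΩc, add_assoc, add_sub_cancel])
    (fun heq => hne <| by
      obtain ⟨hX, -⟩ := Prod.mk.inj heq
      subst hX
      rw [add_left_cancel hXS])
  have hle := mul_le_mul_of_nonneg_left (l1Norm_add_le S (PΩc Ω₀ S₀)) hlam.le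
  rw [← l1Norm_PΩ_add_l1Norm_PΩc Ω₀ S₀] at hlt
  linarith
end

section
/- (Subgradient lower bound under a dual certificate) Let A be a real n₁×n₁ matrix, λ > 0, and let X₀, S₀ be n₁×n₂ matrices, where S₀ has support exactly Ω. Let A X₀ = U Σ Vᵀ be a reduced SVD and T, P_T, P_{T⊥} the associated subspace and projections. Suppose there exist matrices W, F with P_T(W) = 0, P_Ω(F) = 0, and Aᵀ U Vᵀ + Aᵀ W = λ (sgn(S₀) + F), and set β = max(‖W‖, ‖F‖_∞). Then for every n₁×n₂ matrix H: ‖A(X₀ + H)‖_* + λ ‖S₀ − H‖_1 ≥ ‖A X₀‖_* + λ ‖S₀‖_1 + (1 − β) ( ‖P_{T⊥}(A H)‖_* + λ ‖P_{Ω⊥}(H)‖_1 ). -/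
open Matrix BigOperators

attribute [local instance] Classical.propDecidable

theorem exists_gram_diagonalization {m n : ℕ} (M : Matrix (Fin m) (Fin n) ℝ) :
    ∃ O : Matrix (Fin n) (Fin n) ℝ, Oᵀ * O = 1 ∧ O * Oᵀ = 1 ∧
      Mᵀ * M = O * diagonal (Matrix.isHermitian_conjTranspose_mul_self M).eigenvalues * Oᵀ := by
  have hM := Matrix.isHermitian_conjTranspose_mul_self M
  refine ⟨hM.eigenvectorUnitary, ?_, ?_, ?_⟩
  · simpa [star_eq_conjTranspose] using Unitary.coe_star_mul_self hM.eigenvectorUnitary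
  · simpa [star_eq_conjTranspose] using Unitary.coe_mul_star_self hM.eigenvectorUnitary
  · have h := hM.spectral_theorem
    rw [Unitary.conjStarAlgAut_apply] at h
    simpa [star_eq_conjTranspose, Function.comp_def] using h

theorem gram_eigenvalues_nonneg {m n : ℕ} (M : Matrix (Fin m) (Fin n) ℝ) (i : Fin n) :
    0 ≤ (Matrix.isHermitian_conjTranspose_mul_self M).eigenvalues i :=
  (Matrix.posSemidef_conjTranspose_mul_self M).eigenvalues_nonneg i

theorem mulVec_dotProduct_mulVec {m n k : ℕ} (P : Matrix (Fin m) (Fin n) ℝ)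
    (Q : Matrix (Fin m) (Fin k) ℝ) (x : Fin n → ℝ) (y : Fin k → ℝ) :
    (P *ᵥ x) ⬝ᵥ (Q *ᵥ y) = x ⬝ᵥ ((Pᵀ * Q) *ᵥ y) := by
  rw [← mulVec_mulVec, dotProduct_mulVec x, vecMul_transpose]

theorem mulVec_dotProduct_self_of_isometry {m n : ℕ} {P : Matrix (Fin m) (Fin n) ℝ}
    (hP : Pᵀ * P = 1) (x : Fin n → ℝ) : (P *ᵥ x) ⬝ᵥ (P *ᵥ x) = x ⬝ᵥ x := by
  rw [mulVec_dotProduct_mulVec, hP, one_mulVec]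

/-- A matrix whose Gram matrix is orthogonally diagonalized with eigenvalues at most `c`
has squared operator norm at most `c`. -/
theorem mulVec_dotProduct_self_le_of_gram {m n : ℕ} {G : Matrix (Fin m) (Fin n) ℝ}
    {O : Matrix (Fin n) (Fin n) ℝ} {d : Fin n → ℝ} {c : ℝ} (hO : O * Oᵀ = 1)
    (hG : Gᵀ * G = O * diagonal d * Oᵀ) (hd : ∀ i, d i ≤ c) (x : Fin n → ℝ) :
    (G *ᵥ x) ⬝ᵥ (G *ᵥ x) ≤ c * (x ⬝ᵥ x) := by
  have hx : (Oᵀ *ᵥ x) ⬝ᵥ (Oᵀ *ᵥ x) = x ⬝ᵥ x :=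
    mulVec_dotProduct_self_of_isometry (by simpa using hO) x
  have hGx : (G *ᵥ x) ⬝ᵥ (G *ᵥ x) = (Oᵀ *ᵥ x) ⬝ᵥ (diagonal d *ᵥ (Oᵀ *ᵥ x)) := by
    rw [mulVec_dotProduct_mulVec, hG, mulVec_mulVec, mulVec_dotProduct_mulVec,
      transpose_transpose, Matrix.mul_assoc]
  rw [hGx, ← hx]
  simp only [dotProduct, mulVec_diagonal, Finset.mul_sum]
  refine Finset.sum_le_sum fun i _ => ?_
  nlinarith [mul_le_mul_of_nonneg_right (hd i) (mul_self_nonneg ((Oᵀ *ᵥ x) i))]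

theorem mulVec_dotProduct_self_le_specNorm {m n : ℕ} (M : Matrix (Fin m) (Fin n) ℝ)
    (x : Fin n → ℝ) : (M *ᵥ x) ⬝ᵥ (M *ᵥ x) ≤ specNorm M ^ 2 * (x ⬝ᵥ x) := by
  obtain ⟨O, -, hO, hM⟩ := exists_gram_diagonalization M
  refine mulVec_dotProduct_self_le_of_gram hO hM (fun i => ?_) x
  have hle : Real.sqrt ((Matrix.isHermitian_conjTranspose_mul_self M).eigenvalues i)
      ≤ specNorm M := le_ciSup (f := fun i =>
        Real.sqrt ((Matrix.isHermitian_conjTranspose_mul_self M).eigenvalues i))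
      (Set.finite_range _).bddAbove i
  calc _ = Real.sqrt ((Matrix.isHermitian_conjTranspose_mul_self M).eigenvalues i) ^ 2 :=
        (Real.sq_sqrt (gram_eigenvalues_nonneg M i)).symm
    _ ≤ _ := by gcongr

theorem specNorm_nonneg {m n : ℕ} (M : Matrix (Fin m) (Fin n) ℝ) : 0 ≤ specNorm M :=
  Real.iSup_nonneg fun _ => Real.sqrt_nonneg _

theorem nuclearNorm_nonneg {m n : ℕ} (M : Matrix (Fin m) (Fin n) ℝ) : 0 ≤ nuclearNorm M :=
  Finset.sum_nonneg fun _ _ => Real.sqrt_nonneg _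

theorem dotProduct_le_sqrt_mul_sqrt {n : ℕ} (x y : Fin n → ℝ) :
    x ⬝ᵥ y ≤ Real.sqrt (x ⬝ᵥ x) * Real.sqrt (y ⬝ᵥ y) := by
  simpa [dotProduct, pow_two] using Real.sum_mul_le_sqrt_mul_sqrt Finset.univ x y

/-- Trace duality: the pairing with a matrix of operator norm at most `c` is bounded by
`c` times the nuclear norm. -/
theorem trace_transpose_mul_le_nuclearNorm {m n : ℕ} {c : ℝ} (hc : 0 ≤ c)
    {Q : Matrix (Fin m) (Fin n) ℝ} (M : Matrix (Fin m) (Fin n) ℝ)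
    (hQ : ∀ x, (Q *ᵥ x) ⬝ᵥ (Q *ᵥ x) ≤ c ^ 2 * (x ⬝ᵥ x)) :
    trace (Qᵀ * M) ≤ c * nuclearNorm M := by
  obtain ⟨O, hO', hO, hM⟩ := exists_gram_diagonalization M
  have htr : trace (Qᵀ * M) = ∑ i, (Q *ᵥ O.col i) ⬝ᵥ (M *ᵥ O.col i) := by
    calc trace (Qᵀ * M) = trace (Qᵀ * M * (O * Oᵀ)) := by rw [hO, Matrix.mul_one]
      _ = trace ((Q * O)ᵀ * (M * O)) := by
        rw [← Matrix.mul_assoc, trace_mul_comm, transpose_mul]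
        simp only [Matrix.mul_assoc]
      _ = _ := rfl
  rw [htr, nuclearNorm, Finset.mul_sum]
  refine Finset.sum_le_sum fun i _ => (dotProduct_le_sqrt_mul_sqrt _ _).trans ?_
  have hOi : O.col i ⬝ᵥ O.col i = 1 :=
    (congrFun (congrFun hO' i) i).trans (one_apply_eq i)
  have hMi : (M *ᵥ O.col i) ⬝ᵥ (M *ᵥ O.col i) =
      (Matrix.isHermitian_conjTranspose_mul_self M).eigenvalues i := by
    have h : (M * O)ᵀ * (M * O) =
        diagonal (Matrix.isHermitian_conjTranspose_mul_self M).eigenvalues := by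
      calc (M * O)ᵀ * (M * O) = Oᵀ * (Mᵀ * M) * O := by
            simp only [transpose_mul, Matrix.mul_assoc]
        _ = (Oᵀ * O) * diagonal (Matrix.isHermitian_conjTranspose_mul_self M).eigenvalues *
            (Oᵀ * O) := by rw [hM]; simp only [Matrix.mul_assoc]
        _ = _ := by rw [hO', Matrix.one_mul, Matrix.mul_one]
    exact (congrFun (congrFun h i) i).trans (diagonal_apply_eq _ i)
  rw [hMi]
  gcongr
  rw [Real.sqrt_le_left hc]
  simpa [hOi] using hQ (O.col i)

/-- The nuclear norm is attained in the trace duality by a contraction. -/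
theorem exists_contraction_trace_eq_nuclearNorm {m n : ℕ} (M : Matrix (Fin m) (Fin n) ℝ) :
    ∃ G : Matrix (Fin m) (Fin n) ℝ, (∀ x, (G *ᵥ x) ⬝ᵥ (G *ᵥ x) ≤ x ⬝ᵥ x) ∧
      trace (Gᵀ * M) = nuclearNorm M := by
  obtain ⟨O, hO', hO, hM⟩ := exists_gram_diagonalization M
  have hnn := gram_eigenvalues_nonneg M
  rw [nuclearNorm]
  set e := (Matrix.isHermitian_conjTranspose_mul_self M).eigenvalues
  set s : Fin n → ℝ := fun i => (Real.sqrt (e i))⁻¹ with hs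
  have hGM : (M * O * diagonal s * Oᵀ)ᵀ * M = O * diagonal (fun i => s i * e i) * Oᵀ := by
    calc (M * O * diagonal s * Oᵀ)ᵀ * M = O * diagonal s * Oᵀ * (Mᵀ * M) := by
          simp only [transpose_mul, transpose_transpose, diagonal_transpose, Matrix.mul_assoc]
      _ = O * (diagonal s * (Oᵀ * O) * diagonal e) * Oᵀ := by
          rw [hM]; simp only [Matrix.mul_assoc]
      _ = _ := by rw [hO', Matrix.mul_one, diagonal_mul_diagonal]
  have hse : ∀ i, s i * e i = Real.sqrt (e i) := fun i => by
    simp only [hs]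
    rw [inv_mul_eq_div, Real.div_sqrt]
  refine ⟨M * O * diagonal s * Oᵀ, fun x => ?_, ?_⟩
  · have hGG : (M * O * diagonal s * Oᵀ)ᵀ * (M * O * diagonal s * Oᵀ) =
        O * diagonal (fun i => s i * e i * s i) * Oᵀ := by
      calc _ = (M * O * diagonal s * Oᵀ)ᵀ * M * (O * diagonal s * Oᵀ) := by
            simp only [Matrix.mul_assoc]
        _ = O * (diagonal (fun i => s i * e i) * (Oᵀ * O) * diagonal s) * Oᵀ := by
            rw [hGM]; simp only [Matrix.mul_assoc]
        _ = _ := by rw [hO', Matrix.mul_one, diagonal_mul_diagonal]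
    refine (mulVec_dotProduct_self_le_of_gram (c := 1) hO hGG (fun i => ?_) x).trans_eq
      (one_mul _)
    rw [hse]
    exact mul_inv_le_one
  · rw [hGM, trace_mul_comm, ← Matrix.mul_assoc, hO', Matrix.one_mul, trace_diagonal]
    exact Finset.sum_congr rfl fun i _ => hse i

theorem trace_transpose_mul_PTperp {m n r : ℕ} (U : Matrix (Fin m) (Fin r) ℝ)
    (V : Matrix (Fin n) (Fin r) ℝ) (P Q : Matrix (Fin m) (Fin n) ℝ) :
    trace ((PTperp U V P)ᵀ * Q) = trace (Pᵀ * PTperp U V Q) := by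
  have h : (PTperp U V P)ᵀ * Q = (1 - V * Vᵀ) * (Pᵀ * ((1 - U * Uᵀ) * Q)) := by
    simp only [PTperp, transpose_mul, transpose_sub, transpose_one, transpose_transpose,
      Matrix.mul_assoc]
  rw [h, trace_mul_comm, PTperp]
  simp only [Matrix.mul_assoc]

theorem PTperp_eq_sub_PT {m n r : ℕ} (U : Matrix (Fin m) (Fin r) ℝ)
    (V : Matrix (Fin n) (Fin r) ℝ) (M : Matrix (Fin m) (Fin n) ℝ) :
    PTperp U V M = M - PT U V M := by
  simp only [PTperp, PT, Matrix.sub_mul, Matrix.mul_sub, Matrix.one_mul, Matrix.mul_one]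
  abel

theorem nuclearNorm_le_trace_of_isReducedSVD {m n r : ℕ} {X : Matrix (Fin m) (Fin n) ℝ}
    {U : Matrix (Fin m) (Fin r) ℝ} {S : Matrix (Fin r) (Fin r) ℝ} {V : Matrix (Fin n) (Fin r) ℝ}
    (h : IsReducedSVD X U S V) :
    nuclearNorm X ≤ trace ((U * Vᵀ)ᵀ * X) := by
  obtain ⟨hU, hV, hS, hpos, rfl⟩ := h
  obtain ⟨G, hG, hGX⟩ := exists_contraction_trace_eq_nuclearNorm (U * S * Vᵀ)
  have key : ∀ Q : Matrix (Fin m) (Fin n) ℝ,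
      trace (Qᵀ * (U * S * Vᵀ)) = ∑ k, ((Q *ᵥ V.col k) ⬝ᵥ U.col k) * S k k := fun Q => by
    have hSd : S = diagonal (fun k => S k k) := hS.diagonal_diag.symm
    calc trace (Qᵀ * (U * S * Vᵀ)) = trace ((Q * V)ᵀ * U * S) := by
          rw [← Matrix.mul_assoc, trace_mul_comm]
          simp only [transpose_mul, Matrix.mul_assoc]
      _ = trace ((Q * V)ᵀ * U * diagonal (fun k => S k k)) := by rw [← hSd]
      _ = _ := by
        simp only [trace, diag_apply, mul_diagonal]
        rfl
  rw [← hGX, key, key]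
  refine Finset.sum_le_sum fun k _ => mul_le_mul_of_nonneg_right ?_ (hpos k).le
  have hUk : U.col k ⬝ᵥ U.col k = 1 :=
    (congrFun (congrFun hU k) k).trans (one_apply_eq k)
  have hVk : V.col k ⬝ᵥ V.col k = 1 :=
    (congrFun (congrFun hV k) k).trans (one_apply_eq k)
  have hUV : ((U * Vᵀ) *ᵥ V.col k) = U.col k := by
    have h : U * Vᵀ * V = U := by rw [Matrix.mul_assoc, hV, Matrix.mul_one]
    ext i
    exact congrFun (congrFun h i) k
  rw [hUV, hUk]
  refine (dotProduct_le_sqrt_mul_sqrt _ _).trans ?_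
  rw [hUk, Real.sqrt_one, mul_one, Real.sqrt_le_one]
  exact (hG _).trans_eq hVk

theorem one_sub_isometry_mul_transpose_idempotent {m r : ℕ} {U : Matrix (Fin m) (Fin r) ℝ}
    (hU : Uᵀ * U = 1) : (1 - U * Uᵀ)ᵀ * (1 - U * Uᵀ) = 1 - U * Uᵀ := by
  have h : U * Uᵀ * (U * Uᵀ) = U * Uᵀ := by
    rw [Matrix.mul_assoc, ← Matrix.mul_assoc Uᵀ, hU, Matrix.one_mul]
  simp only [transpose_sub, transpose_one, transpose_mul, transpose_transpose, Matrix.sub_mul,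
    Matrix.mul_sub, Matrix.one_mul, Matrix.mul_one, h]
  abel

theorem one_sub_isometry_mul_transpose_mulVec {m r : ℕ} {U : Matrix (Fin m) (Fin r) ℝ}
    (hU : Uᵀ * U = 1) (x : Fin m → ℝ) :
    ((1 - U * Uᵀ) *ᵥ x) ⬝ᵥ ((1 - U * Uᵀ) *ᵥ x) = x ⬝ᵥ x - (Uᵀ *ᵥ x) ⬝ᵥ (Uᵀ *ᵥ x) := by
  rw [mulVec_dotProduct_mulVec, one_sub_isometry_mul_transpose_idempotent hU,
    mulVec_dotProduct_mulVec, transpose_transpose, sub_mulVec, one_mulVec, dotProduct_sub]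

theorem mul_transpose_add_PTperp_contraction {m n r : ℕ} {U : Matrix (Fin m) (Fin r) ℝ}
    {V : Matrix (Fin n) (Fin r) ℝ} (hU : Uᵀ * U = 1) (hV : Vᵀ * V = 1)
    {G : Matrix (Fin m) (Fin n) ℝ} (hG : ∀ x, (G *ᵥ x) ⬝ᵥ (G *ᵥ x) ≤ x ⬝ᵥ x) (x : Fin n → ℝ) :
    ((U * Vᵀ + PTperp U V G) *ᵥ x) ⬝ᵥ ((U * Vᵀ + PTperp U V G) *ᵥ x) ≤ x ⬝ᵥ x := by
  have hcross : ((U * Vᵀ) *ᵥ x) ⬝ᵥ (PTperp U V G *ᵥ x) = 0 := by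
    have h : (U * Vᵀ)ᵀ * PTperp U V G = 0 := by
      have h0 : Uᵀ * (1 - U * Uᵀ) = 0 := by
        rw [Matrix.mul_sub, ← Matrix.mul_assoc, hU, Matrix.mul_one, Matrix.one_mul, sub_self]
      rw [PTperp, transpose_mul, transpose_transpose, Matrix.mul_assoc, ← Matrix.mul_assoc Uᵀ,
        ← Matrix.mul_assoc Uᵀ, h0]
      simp
    rw [mulVec_dotProduct_mulVec, h, zero_mulVec, dotProduct_zero]
  have h1 : ((U * Vᵀ) *ᵥ x) ⬝ᵥ ((U * Vᵀ) *ᵥ x) = (Vᵀ *ᵥ x) ⬝ᵥ (Vᵀ *ᵥ x) := by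
    rw [← mulVec_mulVec, mulVec_dotProduct_self_of_isometry hU]
  have h2 : (PTperp U V G *ᵥ x) ⬝ᵥ (PTperp U V G *ᵥ x) ≤
      x ⬝ᵥ x - (Vᵀ *ᵥ x) ⬝ᵥ (Vᵀ *ᵥ x) := by
    rw [← one_sub_isometry_mul_transpose_mulVec hV, PTperp, ← mulVec_mulVec, ← mulVec_mulVec,
      one_sub_isometry_mul_transpose_mulVec hU]
    have hn : 0 ≤ (Uᵀ *ᵥ (G *ᵥ ((1 - V * Vᵀ) *ᵥ x))) ⬝ᵥ (Uᵀ *ᵥ (G *ᵥ ((1 - V * Vᵀ) *ᵥ x))) :=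
      Finset.sum_nonneg fun _ _ => mul_self_nonneg _
    linarith [hG ((1 - V * Vᵀ) *ᵥ x)]
  rw [add_mulVec, add_dotProduct, dotProduct_add, dotProduct_add, hcross, h1,
    dotProduct_comm (PTperp U V G *ᵥ x), hcross]
  linarith

/-- Subgradient inequality for the nuclear norm at a matrix with a known reduced SVD. -/
theorem nuclearNorm_add_ge {m n r : ℕ} {X : Matrix (Fin m) (Fin n) ℝ}
    {U : Matrix (Fin m) (Fin r) ℝ} {S : Matrix (Fin r) (Fin r) ℝ} {V : Matrix (Fin n) (Fin r) ℝ}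
    (h : IsReducedSVD X U S V) (K : Matrix (Fin m) (Fin n) ℝ) :
    nuclearNorm X + trace ((U * Vᵀ)ᵀ * K) + nuclearNorm (PTperp U V K) ≤ nuclearNorm (X + K) := by
  have hX := nuclearNorm_le_trace_of_isReducedSVD h
  obtain ⟨hU, hV, -, -, hXeq⟩ := h
  obtain ⟨G, hG, hGK⟩ := exists_contraction_trace_eq_nuclearNorm (PTperp U V K)
  have hdual := trace_transpose_mul_le_nuclearNorm zero_le_one (X + K)
    (Q := U * Vᵀ + PTperp U V G)
    (fun x => by simpa using mul_transpose_add_PTperp_contraction hU hV hG x)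
  have hperp : PTperp U V X = 0 := by
    have h0 : (1 - U * Uᵀ) * U = 0 := by
      rw [Matrix.sub_mul, Matrix.mul_assoc, hU, Matrix.mul_one, Matrix.one_mul, sub_self]
    rw [hXeq, PTperp, ← Matrix.mul_assoc, ← Matrix.mul_assoc, h0]
    simp
  rw [transpose_add, Matrix.add_mul, Matrix.mul_add, Matrix.mul_add, trace_add, trace_add,
    trace_add, trace_transpose_mul_PTperp, trace_transpose_mul_PTperp, hperp, hGK] at hdual
  simp only [Matrix.mul_zero, trace_zero] at hdual
  linarith

theorem trace_transpose_mul_eq_sum {m n : ℕ} (P Q : Matrix (Fin m) (Fin n) ℝ) :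
    trace (Pᵀ * Q) = ∑ i, ∑ j, P i j * Q i j := by
  rw [Finset.sum_comm]
  rfl

/-- Subgradient inequality for the entrywise `ℓ¹` norm. -/
theorem l1Norm_sub_ge {m n : ℕ} {S : Matrix (Fin m) (Fin n) ℝ} {Ω : Finset (Fin m × Fin n)}
    (hsupp : ∀ i j, S i j ≠ 0 ↔ (i, j) ∈ Ω) (H : Matrix (Fin m) (Fin n) ℝ) :
    l1Norm S - trace ((sgn S)ᵀ * H) + l1Norm (PΩc Ω H) ≤ l1Norm (S - H) := by
  rw [trace_transpose_mul_eq_sum]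
  simp only [l1Norm, ← Finset.sum_sub_distrib, ← Finset.sum_add_distrib]
  refine Finset.sum_le_sum fun i _ => Finset.sum_le_sum fun j _ => ?_
  simp only [PΩc, PΩ, sgn, Matrix.sub_apply]
  rcases lt_trichotomy (S i j) 0 with hS | hS | hS
  · rw [if_pos ((hsupp i j).1 hS.ne), Real.sign_of_neg hS, abs_of_neg hS, sub_self, abs_zero]
    linarith [neg_le_abs (S i j - H i j)]
  · rw [if_neg (fun h => (hsupp i j).2 h hS), hS]
    simp
  · rw [if_pos ((hsupp i j).1 hS.ne'), Real.sign_of_pos hS, abs_of_pos hS, sub_self, abs_zero]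
    linarith [le_abs_self (S i j - H i j)]

theorem neg_trace_transpose_mul_le_supNorm {m n : ℕ} {F : Matrix (Fin m) (Fin n) ℝ}
    {Ω : Finset (Fin m × Fin n)} (hF : PΩ Ω F = 0) (H : Matrix (Fin m) (Fin n) ℝ) :
    -trace (Fᵀ * H) ≤ supNorm F * l1Norm (PΩc Ω H) := by
  rw [trace_transpose_mul_eq_sum]
  simp only [l1Norm, ← Finset.sum_neg_distrib, Finset.mul_sum]
  refine Finset.sum_le_sum fun i _ => Finset.sum_le_sum fun j _ => ?_
  have hFij := congrFun (congrFun hF i) j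
  simp only [PΩc, PΩ, Matrix.sub_apply, Matrix.zero_apply] at hFij ⊢
  by_cases hij : (i, j) ∈ Ω
  · rw [if_pos hij] at hFij ⊢
    simp [hFij]
  · rw [if_neg hij, sub_zero]
    have hle : |F i j| ≤ supNorm F :=
      le_ciSup (f := fun p : Fin m × Fin n => |F p.1 p.2|) (Set.finite_range _).bddAbove (i, j)
    calc -(F i j * H i j) ≤ |F i j * H i j| := neg_le_abs _
      _ = |F i j| * |H i j| := abs_mul _ _
      _ ≤ _ := by gcongr

theorem l1Norm_nonneg {m n : ℕ} (M : Matrix (Fin m) (Fin n) ℝ) : 0 ≤ l1Norm M :=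
  Finset.sum_nonneg fun _ _ => Finset.sum_nonneg fun _ _ => abs_nonneg _

theorem subgradient_lower_bound {n₁ n₂ r : ℕ} (A : Matrix (Fin n₁) (Fin n₁) ℝ)
    (lam : ℝ) (hlam : 0 < lam) (X₀ S₀ : Matrix (Fin n₁) (Fin n₂) ℝ)
    (Ω : Finset (Fin n₁ × Fin n₂)) (hsupp : ∀ i j, S₀ i j ≠ 0 ↔ (i, j) ∈ Ω)
    (U : Matrix (Fin n₁) (Fin r) ℝ) (Sig : Matrix (Fin r) (Fin r) ℝ)
    (V : Matrix (Fin n₂) (Fin r) ℝ) (hSVD : IsReducedSVD (A * X₀) U Sig V)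
    (W F : Matrix (Fin n₁) (Fin n₂) ℝ) (hW : PT U V W = 0) (hF : PΩ Ω F = 0)
    (hdual : Aᵀ * (U * Vᵀ) + Aᵀ * W = lam • (sgn S₀ + F)) :
    ∀ H : Matrix (Fin n₁) (Fin n₂) ℝ,
      nuclearNorm (A * X₀) + lam * l1Norm S₀ +
        (1 - max (specNorm W) (supNorm F)) *
          (nuclearNorm (PTperp U V (A * H)) + lam * l1Norm (PΩc Ω H)) ≤
      nuclearNorm (A * (X₀ + H)) + lam * l1Norm (S₀ - H) := by
  intro H
  have hnuc := nuclearNorm_add_ge hSVD (A * H)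
  have hl1 := mul_le_mul_of_nonneg_left (l1Norm_sub_ge hsupp H) hlam.le
  have hFH := mul_le_mul_of_nonneg_left (neg_trace_transpose_mul_le_supNorm hF H) hlam.le
  have hWH : trace (Wᵀ * (A * H)) ≤ specNorm W * nuclearNorm (PTperp U V (A * H)) := by
    have hWperp : PTperp U V W = W := by rw [PTperp_eq_sub_PT, hW, sub_zero]
    calc trace (Wᵀ * (A * H)) = trace (Wᵀ * PTperp U V (A * H)) := by
          rw [← trace_transpose_mul_PTperp, hWperp]
      _ ≤ _ := trace_transpose_mul_le_nuclearNorm (specNorm_nonneg W) _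
          (mulVec_dotProduct_self_le_specNorm W)
  have hpair : trace ((U * Vᵀ)ᵀ * (A * H)) + trace (Wᵀ * (A * H)) =
      lam * (trace ((sgn S₀)ᵀ * H) + trace (Fᵀ * H)) := by
    have h := congrArg (fun M => trace (Mᵀ * H)) hdual
    simpa only [transpose_add, transpose_mul, transpose_smul, transpose_transpose,
      Matrix.add_mul, Matrix.smul_mul, trace_add, trace_smul, smul_eq_mul, Matrix.mul_assoc]
      using h
  have hβW := mul_le_mul_of_nonneg_right (le_max_left (specNorm W) (supNorm F))
    (nuclearNorm_nonneg (PTperp U V (A * H)))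
  have hβF := mul_le_mul_of_nonneg_right (le_max_right (specNorm W) (supNorm F))
    (mul_nonneg hlam.le (l1Norm_nonneg (PΩc Ω H)))
  rw [Matrix.mul_add A X₀ H]
  linarith
end

section
/- Let Ω ⊆ {1,…,n₁}×{1,…,n₂} and let T be the subspace associated with orthonormal-column matrices U ∈ ℝ^{n₁×r}, V ∈ ℝ^{n₂×r}. If ‖P_Ω P_T‖ ≤ 1/2 (operator norm with respect to the Frobenius norm), then for every n₁×n₂ matrix Z: ‖P_Ω(Z)‖_F ≤ ‖P_{Ω⊥}(Z)‖_F + 2 ‖P_{T⊥}(Z)‖_F. -/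
open Matrix BigOperators

attribute [local instance] Classical.propDecidable

theorem exists_norm_map_le_of_norm_le_one {E F : Type*} [NormedAddCommGroup E]
    [NormedSpace ℝ E] [FiniteDimensional ℝ E] [NormedAddCommGroup F] [NormedSpace ℝ F]
    (L : E →ₗ[ℝ] F) : ∃ C : ℝ, ∀ x, ‖x‖ ≤ 1 → ‖L x‖ ≤ C :=
  ⟨‖LinearMap.toContinuousLinearMap L‖,
    (LinearMap.toContinuousLinearMap L).unit_le_opNorm⟩

section Frobenius

open scoped Matrix.Norms.Frobenius

variable {m n : ℕ}

theorem frobNorm_eq_norm (M : Matrix (Fin m) (Fin n) ℝ) : frobNorm M = ‖M‖ := by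
  rw [Matrix.frobenius_norm_def, frobNorm, Real.sqrt_eq_rpow]
  simp

theorem frobNorm_nonneg (M : Matrix (Fin m) (Fin n) ℝ) : 0 ≤ frobNorm M :=
  Real.sqrt_nonneg _

theorem frobNorm_add_le (M N : Matrix (Fin m) (Fin n) ℝ) :
    frobNorm (M + N) ≤ frobNorm M + frobNorm N := by
  simpa only [frobNorm_eq_norm] using norm_add_le M N

/-- In finite dimension the supremum defining `opNorm` is that of a bounded family, so `opNorm`
controls every linear map. -/
theorem frobNorm_map_le_opNorm_mul
    (L : Matrix (Fin m) (Fin n) ℝ →ₗ[ℝ] Matrix (Fin m) (Fin n) ℝ)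
    (X : Matrix (Fin m) (Fin n) ℝ) :
    frobNorm (L X) ≤ opNorm L * frobNorm X := by
  have hbdd : BddAbove (Set.range fun X : {X : Matrix (Fin m) (Fin n) ℝ // frobNorm X ≤ 1} =>
      frobNorm (L X.1)) := by
    obtain ⟨C, hC⟩ := exists_norm_map_le_of_norm_le_one L
    refine ⟨C, ?_⟩
    rintro _ ⟨⟨Y, hY⟩, rfl⟩
    rw [frobNorm_eq_norm] at hY
    simpa only [frobNorm_eq_norm] using hC Y hY
  rcases eq_or_ne X 0 with rfl | hX
  · simp [frobNorm_eq_norm]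
  have hpos : 0 < ‖X‖ := norm_pos_iff.mpr hX
  have hunit : frobNorm (‖X‖⁻¹ • X) ≤ 1 := by
    rw [frobNorm_eq_norm, norm_smul, norm_inv, norm_norm, inv_mul_cancel₀ hpos.ne']
  have hle : frobNorm (L (‖X‖⁻¹ • X)) ≤ opNorm L := le_ciSup hbdd ⟨‖X‖⁻¹ • X, hunit⟩
  rw [frobNorm_eq_norm, map_smul, norm_smul, norm_inv, norm_norm, inv_mul_le_iff₀ hpos] at hle
  rw [frobNorm_eq_norm, frobNorm_eq_norm, mul_comm]
  exact hle

end Frobenius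

theorem PΩ_add {m n : ℕ} (Ω : Finset (Fin m × Fin n)) (M N : Matrix (Fin m) (Fin n) ℝ) :
    PΩ Ω (M + N) = PΩ Ω M + PΩ Ω N := by
  ext i j
  by_cases hij : (i, j) ∈ Ω <;> simp [PΩ, hij]

theorem PΩ_smul {m n : ℕ} (Ω : Finset (Fin m × Fin n)) (c : ℝ)
    (M : Matrix (Fin m) (Fin n) ℝ) : PΩ Ω (c • M) = c • PΩ Ω M := by
  ext i j
  by_cases hij : (i, j) ∈ Ω <;> simp [PΩ, hij]

theorem frobNorm_PΩ_le {m n : ℕ} (Ω : Finset (Fin m × Fin n)) (M : Matrix (Fin m) (Fin n) ℝ) :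
    frobNorm (PΩ Ω M) ≤ frobNorm M := by
  refine Real.sqrt_le_sqrt (Finset.sum_le_sum fun i _ => Finset.sum_le_sum fun j _ => ?_)
  by_cases hij : (i, j) ∈ Ω <;> simp [PΩ, hij, sq_nonneg]

theorem PT_add {m n r : ℕ} (U : Matrix (Fin m) (Fin r) ℝ) (V : Matrix (Fin n) (Fin r) ℝ)
    (M N : Matrix (Fin m) (Fin n) ℝ) : PT U V (M + N) = PT U V M + PT U V N := by
  simp only [PT, Matrix.mul_add, Matrix.add_mul]
  abel

theorem PT_smul {m n r : ℕ} (U : Matrix (Fin m) (Fin r) ℝ) (V : Matrix (Fin n) (Fin r) ℝ)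
    (c : ℝ) (M : Matrix (Fin m) (Fin n) ℝ) : PT U V (c • M) = c • PT U V M := by
  simp only [PT, Matrix.mul_smul, Matrix.smul_mul, smul_add, smul_sub]

theorem PT_add_PTperp {m n r : ℕ} (U : Matrix (Fin m) (Fin r) ℝ)
    (V : Matrix (Fin n) (Fin r) ℝ) (M : Matrix (Fin m) (Fin n) ℝ) :
    PT U V M + PTperp U V M = M := by
  simp only [PT, PTperp, Matrix.sub_mul, Matrix.mul_sub, Matrix.one_mul, Matrix.mul_one]
  abel

theorem pOmega_le_pOmegaPerp_add_pTperp {n₁ n₂ r : ℕ} (Ω : Finset (Fin n₁ × Fin n₂))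
    (U : Matrix (Fin n₁) (Fin r) ℝ) (V : Matrix (Fin n₂) (Fin r) ℝ)
    (hU : Uᵀ * U = 1) (hV : Vᵀ * V = 1)
    (h : opNorm (fun M => PΩ Ω (PT U V M)) ≤ 1/2) :
    ∀ Z : Matrix (Fin n₁) (Fin n₂) ℝ,
      frobNorm (PΩ Ω Z) ≤ frobNorm (PΩc Ω Z) + 2 * frobNorm (PTperp U V Z) := by
  intro Z
  let L : Matrix (Fin n₁) (Fin n₂) ℝ →ₗ[ℝ] Matrix (Fin n₁) (Fin n₂) ℝ :=
    { toFun := fun M => PΩ Ω (PT U V M)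
      map_add' := fun M N => by rw [PT_add, PΩ_add]
      map_smul' := fun c M => by rw [PT_smul, PΩ_smul, RingHom.id_apply] }
  have hT : frobNorm (PΩ Ω (PT U V Z)) ≤ 1 / 2 * frobNorm Z :=
    (frobNorm_map_le_opNorm_mul L Z).trans (mul_le_mul_of_nonneg_right h (frobNorm_nonneg Z))
  have hsplit : frobNorm (PΩ Ω Z) ≤
      frobNorm (PΩ Ω (PT U V Z)) + frobNorm (PΩ Ω (PTperp U V Z)) := by
    simpa only [← PΩ_add, PT_add_PTperp] using
      frobNorm_add_le (PΩ Ω (PT U V Z)) (PΩ Ω (PTperp U V Z))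
  have hZ : frobNorm Z ≤ frobNorm (PΩ Ω Z) + frobNorm (PΩc Ω Z) := by
    simpa only [PΩc, add_sub_cancel] using frobNorm_add_le (PΩ Ω Z) (PΩc Ω Z)
  linarith [frobNorm_PΩ_le Ω (PTperp U V Z)]
end

section
/- Let U ∈ ℝ^{n₁×r} and V ∈ ℝ^{n₂×r} have orthonormal columns with max_k ‖Uᵀ e_k‖² ≤ μ r / n₁ and max_j ‖Vᵀ e_j‖² ≤ μ r / n₂, and suppose μ r / min(n₁, n₂) ≤ 1. Then for all standard basis vectors e_k ∈ ℝ^{n₁} and e_j ∈ ℝ^{n₂}: ‖P_T(e_k e_jᵀ)‖_F ≤ √(2 μ r / min(n₁, n₂)). -/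
open Matrix BigOperators

attribute [local instance] Classical.propDecidable

/-- For orthonormal columns, row `k` of the projection `W * Wᵀ` has squared norm equal to its
diagonal entry. -/
theorem sum_sq_row_mul_transpose {m r : ℕ} (W : Matrix (Fin m) (Fin r) ℝ) (hW : Wᵀ * W = 1)
    (k : Fin m) : ∑ x, (W * Wᵀ) k x ^ 2 = (W * Wᵀ) k k := by
  have hidem : (W * Wᵀ) * (W * Wᵀ) = W * Wᵀ := by
    rw [Matrix.mul_assoc, ← Matrix.mul_assoc Wᵀ, hW, Matrix.one_mul]
  have hsymm (x : Fin m) : (W * Wᵀ) x k = (W * Wᵀ) k x := by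
    simp [Matrix.mul_apply, mul_comm]
  conv_rhs => rw [← hidem, Matrix.mul_apply]
  exact Finset.sum_congr rfl fun x _ => by rw [hsymm, sq]

theorem mul_transpose_apply_self {m r : ℕ} (W : Matrix (Fin m) (Fin r) ℝ) (k : Fin m) :
    (W * Wᵀ) k k = ∑ i, W k i ^ 2 := by
  simp [Matrix.mul_apply, sq]

theorem PT_single_apply {m n r : ℕ} (U : Matrix (Fin m) (Fin r) ℝ) (V : Matrix (Fin n) (Fin r) ℝ)
    (k x : Fin m) (j y : Fin n) :
    PT U V (Matrix.single k j 1) x y =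
      (U * Uᵀ) k x * (if j = y then 1 else 0) + (if k = x then 1 else 0) * (V * Vᵀ) j y
        - (U * Uᵀ) k x * (V * Vᵀ) j y := by
  have hsymm : (U * Uᵀ) x k = (U * Uᵀ) k x := by
    simp [Matrix.mul_apply, mul_comm]
  have hleft (A : Matrix (Fin m) (Fin m) ℝ) (z : Fin n) :
      (A * Matrix.single k j (1 : ℝ)) x z = A x k * (if j = z then 1 else 0) := by
    simp [Matrix.mul_apply, Matrix.single_apply, ite_and]
  have hright (B : Matrix (Fin n) (Fin n) ℝ) :
      (Matrix.single k j (1 : ℝ) * B) x y = (if k = x then 1 else 0) * B j y := by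
    by_cases h : k = x <;> simp [Matrix.mul_apply, Matrix.single_apply, h]
  rw [PT, Matrix.sub_apply, Matrix.add_apply, hleft, hright,
    Matrix.mul_apply (M := U * Uᵀ * _)]
  simp [hleft, hsymm]

theorem sum_sq_PT_single {m n r : ℕ} (U : Matrix (Fin m) (Fin r) ℝ)
    (V : Matrix (Fin n) (Fin r) ℝ) (hU : Uᵀ * U = 1) (hV : Vᵀ * V = 1) (k : Fin m) (j : Fin n) :
    ∑ x, ∑ y, PT U V (Matrix.single k j 1) x y ^ 2 =
      ∑ i, U k i ^ 2 + ∑ i, V j i ^ 2 - (∑ i, U k i ^ 2) * ∑ i, V j i ^ 2 := by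
  simp only [PT_single_apply, ← mul_transpose_apply_self]
  have hP := sum_sq_row_mul_transpose U hU k
  have hQ := sum_sq_row_mul_transpose V hV j
  set p := (U * Uᵀ) k
  set q := (V * Vᵀ) j
  have hexpand (x : Fin m) (y : Fin n) :
      (p x * (if j = y then 1 else 0) + (if k = x then 1 else 0) * q y - p x * q y) ^ 2 =
        p x ^ 2 * (if j = y then 1 else 0) + (if k = x then 1 else 0) * q y ^ 2
          + p x ^ 2 * q y ^ 2
          + 2 * ((if k = x then p x else 0) * (if j = y then q y else 0))
          - 2 * (p x ^ 2 * (if j = y then q y else 0))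
          - 2 * ((if k = x then p x else 0) * q y ^ 2) := by
    split_ifs <;> ring
  simp only [hexpand, Finset.sum_sub_distrib, Finset.sum_add_distrib, ← Finset.mul_sum,
    ← Finset.sum_mul, hP, hQ, Finset.sum_ite_eq, Finset.mem_univ, if_true]
  ring

theorem pT_stdBasis_bound {n₁ n₂ r : ℕ}
    (U : Matrix (Fin n₁) (Fin r) ℝ) (V : Matrix (Fin n₂) (Fin r) ℝ)
    (hU : Uᵀ * U = 1) (hV : Vᵀ * V = 1) (μ : ℝ)
    (hUinc : ∀ k, ∑ i, (U k i) ^ 2 ≤ μ * (r : ℝ) / (n₁ : ℝ))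
    (hVinc : ∀ j, ∑ i, (V j i) ^ 2 ≤ μ * (r : ℝ) / (n₂ : ℝ))
    (hμ : μ * (r : ℝ) / ((min n₁ n₂ : ℕ) : ℝ) ≤ 1) :
    ∀ (k : Fin n₁) (j : Fin n₂),
      frobNorm (PT U V (Matrix.single k j 1)) ≤
        Real.sqrt (2 * μ * (r : ℝ) / ((min n₁ n₂ : ℕ) : ℝ)) := by
  intro k j
  refine Real.sqrt_le_sqrt ?_
  rw [sum_sq_PT_single U V hU hV]
  have ha : 0 ≤ ∑ i, U k i ^ 2 := Finset.sum_nonneg fun i _ => sq_nonneg _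
  have hb : 0 ≤ ∑ i, V j i ^ 2 := Finset.sum_nonneg fun i _ => sq_nonneg _
  have hn₁ : (0 : ℝ) < n₁ := by exact_mod_cast k.pos
  have hn₂ : (0 : ℝ) < n₂ := by exact_mod_cast j.pos
  have hmin : (0 : ℝ) < ((min n₁ n₂ : ℕ) : ℝ) := by exact_mod_cast lt_min k.pos j.pos
  have hμr : 0 ≤ μ * (r : ℝ) := by
    have h := ha.trans (hUinc k)
    rwa [le_div_iff₀ hn₁, zero_mul] at h
  have h₁ : μ * (r : ℝ) / n₁ ≤ μ * r / ((min n₁ n₂ : ℕ) : ℝ) :=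
    div_le_div_of_nonneg_left hμr hmin (by exact_mod_cast min_le_left n₁ n₂)
  have h₂ : μ * (r : ℝ) / n₂ ≤ μ * r / ((min n₁ n₂ : ℕ) : ℝ) :=
    div_le_div_of_nonneg_left hμr hmin (by exact_mod_cast min_le_right n₁ n₂)
  have htwo : 2 * μ * (r : ℝ) / ((min n₁ n₂ : ℕ) : ℝ) =
      2 * (μ * r / ((min n₁ n₂ : ℕ) : ℝ)) := by ring
  rw [htwo]
  linarith [hUinc k, hVinc j, mul_nonneg ha hb]
end
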